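/- For every N ∈ ℕ, every f ∈ E_N and all multi-indices α, β ∈ ℕⁿ, one has ‖x^α ∂_x^β f‖_{L²(ℝⁿ)} ≤ 2^{(|α|+|β|)/2} · √((N+|α|+|β|)! / N!) · ‖f‖_{L²(ℝⁿ)}, where x^α = x₁^{α₁}⋯x_n^{α_n} and ∂_x^β = ∂_{x₁}^{β₁}⋯∂_{x_n}^{β_n}. -/

import Mathlib

open MeasureTheory

noncomputable section

/-- The one-dimensional Hermite functions
`φ_k(x) = ((-1)^k / √(2^k k! √π)) e^{x²/2} (d/dx)^k e^{-x²}`. -/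
def hermiteFn (k : ℕ) (x : ℝ) : ℝ :=
  ((-1 : ℝ) ^ k / Real.sqrt (2 ^ k * Nat.factorial k * Real.sqrt Real.pi)) *
    Real.exp (x ^ 2 / 2) * iteratedDeriv k (fun y => Real.exp (-(y ^ 2))) x

/-- The `n`-dimensional Hermite functions `Φ_α(x) = ∏_j φ_{α_j}(x_j)`, viewed as
complex-valued functions. -/
def hermitePhi {n : ℕ} (α : Fin n → ℕ) (x : EuclideanSpace ℝ (Fin n)) : ℂ :=
  ∏ j, (hermiteFn (α j) (x j) : ℂ)

/-- `E_N`, the span of the Hermite functions `Φ_α` with `|α| ≤ N`. -/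
def hermiteSpan (n N : ℕ) : Submodule ℂ (EuclideanSpace ℝ (Fin n) → ℂ) :=
  Submodule.span ℂ {f | ∃ α : Fin n → ℕ, (∑ j, α j) ≤ N ∧ f = hermitePhi α}

end
noncomputable section

/-- The partial derivative `∂_{x_j}` of a function on `ℝⁿ`. -/
def partialDerivE {n : ℕ} (j : Fin n) (f : EuclideanSpace ℝ (Fin n) → ℂ) :
    EuclideanSpace ℝ (Fin n) → ℂ :=
  fun x => fderiv ℝ f x (EuclideanSpace.single j 1)

/-- The iterated partial derivative `∂_x^β = ∂_{x_1}^{β_1} ⋯ ∂_{x_n}^{β_n}`. -/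
def multiDerivE {n : ℕ} (β : Fin n → ℕ) (f : EuclideanSpace ℝ (Fin n) → ℂ) :
    EuclideanSpace ℝ (Fin n) → ℂ :=
  (List.finRange n).foldr (fun j g => (partialDerivE j)^[β j] g) f


open Polynomial in
/-- Physicists' Hermite polynomials. -/
noncomputable def hPoly : ℕ → Polynomial ℝ
  | 0 => 1
  | k + 1 => 2 * X * hPoly k - derivative (hPoly k)

open Polynomial in
lemma hPoly_deriv (k : ℕ) : derivative (hPoly (k + 1)) = (2 * (k + 1) : ℝ[X]) * hPoly k := by
  induction k with
  | zero => simp [hPoly]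
  | succ k ih =>
    rw [hPoly, derivative_sub, derivative_mul, ih]
    have h1 : derivative (2 * X : ℝ[X]) = 2 := by simp
    have h2 : derivative ((2 * (k + 1) : ℝ[X]) * hPoly k) =
        (2 * (k + 1) : ℝ[X]) * derivative (hPoly k) := by
      have : (2 * (k + 1) : ℝ[X]) = C (2 * (k + 1) : ℝ) := by
        simp only [map_mul, map_add, map_natCast, map_ofNat, map_one]
      rw [this, derivative_C_mul]
    rw [h1, h2, hPoly]
    push_cast
    ring

lemma iterDeriv_gauss (k : ℕ) : iteratedDeriv k (fun y : ℝ => Real.exp (-(y ^ 2))) =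
    fun x => (-1) ^ k * (hPoly k).eval x * Real.exp (-(x ^ 2)) := by
  induction k with
  | zero => simp [hPoly]
  | succ k ih =>
    rw [iteratedDeriv_succ, ih]
    funext x
    have h1 : HasDerivAt (fun x : ℝ => Real.exp (-(x ^ 2))) (Real.exp (-(x ^ 2)) * (-(2 * x))) x := by
      simpa using ((hasDerivAt_pow 2 x).neg).exp
    have h2 := (((hPoly k).hasDerivAt x).const_mul ((-1 : ℝ) ^ k)).mul h1
    refine (h2.deriv).trans ?_
    simp [hPoly, pow_succ]
    ring

noncomputable def hnc (k : ℕ) : ℝ := Real.sqrt (2 ^ k * Nat.factorial k * Real.sqrt Real.pi)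

lemma hnc_pos (k : ℕ) : 0 < hnc k := by
  unfold hnc; positivity

lemma hnc_succ (k : ℕ) : hnc (k + 1) = Real.sqrt (2 * ((k : ℝ) + 1)) * hnc k := by
  unfold hnc
  rw [← Real.sqrt_mul (by positivity), Nat.factorial_succ]
  congr 1
  push_cast
  ring

lemma hermiteFn_eq (k : ℕ) (x : ℝ) :
    hermiteFn k x = (hnc k)⁻¹ * (hPoly k).eval x * Real.exp (-(x ^ 2 / 2)) := by
  unfold hermiteFn
  rw [iterDeriv_gauss]
  have h : Real.exp (-(x ^ 2)) = Real.exp (-(x ^ 2 / 2)) * Real.exp (-(x ^ 2 / 2)) := by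
    rw [← Real.exp_add]; congr 1; ring
  have h' : Real.exp (x ^ 2 / 2) * Real.exp (-(x ^ 2 / 2)) = 1 := by
    rw [← Real.exp_add]; simp
  have h'' : ((-1 : ℝ) ^ k) * (-1) ^ k = 1 := by
    rw [← mul_pow]; simp
  change (-1 : ℝ) ^ k / hnc k * _ * _ = _
  simp only [h, div_eq_mul_inv]
  calc _ = ((-1 : ℝ) ^ k * (-1) ^ k) * (Real.exp (x ^ 2 / 2) * Real.exp (-(x ^ 2 / 2))) *
      ((hnc k)⁻¹ * (hPoly k).eval x * Real.exp (-(x ^ 2 / 2))) := by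
        simp only [div_eq_mul_inv]; ring
    _ = _ := by rw [h', h'']; simp [div_eq_mul_inv]

lemma sqrt_half_eq (k : ℕ) : Real.sqrt (((k : ℝ) + 1) / 2) = Real.sqrt (2 * ((k : ℝ) + 1)) / 2 := by
  rw [Real.sqrt_eq_iff_mul_self_eq (by positivity) (by positivity)]
  have := Real.mul_self_sqrt (show 0 ≤ 2 * ((k : ℝ) + 1) by positivity)
  nlinarith

/-- up part: `√((k+1)/2) φ_{k+1} = (2 x H_k - H_k') e / (2 nc k)` -/
lemma hermiteFn_up (k : ℕ) (x : ℝ) : Real.sqrt (((k : ℝ) + 1) / 2) * hermiteFn (k + 1) x =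
    (hnc k)⁻¹ * (x * (hPoly k).eval x - (hPoly k).derivative.eval x / 2)
      * Real.exp (-(x ^ 2 / 2)) := by
  rw [hermiteFn_eq, hnc_succ, sqrt_half_eq]
  have := hnc_pos k
  have : 0 < Real.sqrt (2 * ((k : ℝ) + 1)) := by positivity
  simp only [hPoly, Polynomial.eval_sub, Polynomial.eval_mul, Polynomial.eval_X,
    Polynomial.eval_ofNat]
  field_simp

lemma hermiteFn_down (k : ℕ) (x : ℝ) : Real.sqrt ((k : ℝ) / 2) * hermiteFn (k - 1) x =
    (hnc k)⁻¹ * ((hPoly k).derivative.eval x / 2) * Real.exp (-(x ^ 2 / 2)) := by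
  cases k with
  | zero => simp [hPoly]
  | succ k =>
    rw [hermiteFn_eq, hnc_succ, hPoly_deriv, Nat.cast_succ, sqrt_half_eq, Nat.add_sub_cancel]
    have := hnc_pos k
    have h0 : 0 < Real.sqrt (2 * ((k : ℝ) + 1)) := by positivity
    have h1 := Real.mul_self_sqrt (show 0 ≤ 2 * ((k : ℝ) + 1) by positivity)
    simp only [Polynomial.eval_mul, Polynomial.eval_add, Polynomial.eval_one,
      Polynomial.eval_ofNat, Polynomial.eval_natCast]
    generalize Real.sqrt (2 * ((k : ℝ) + 1)) = s at *
    rw [← h1]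
    field_simp

lemma hermiteFn_mul_x (k : ℕ) (x : ℝ) : x * hermiteFn k x =
    Real.sqrt ((k : ℝ) / 2) * hermiteFn (k - 1) x +
      Real.sqrt (((k : ℝ) + 1) / 2) * hermiteFn (k + 1) x := by
  rw [hermiteFn_down, hermiteFn_up, hermiteFn_eq]; ring

lemma hermiteFn_hasDerivAt (k : ℕ) (x : ℝ) : HasDerivAt (hermiteFn k)
    (Real.sqrt ((k : ℝ) / 2) * hermiteFn (k - 1) x -
      Real.sqrt (((k : ℝ) + 1) / 2) * hermiteFn (k + 1) x) x := by
  rw [hermiteFn_down, hermiteFn_up]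
  have h0 : hermiteFn k = fun x => (hnc k)⁻¹ * (hPoly k).eval x * Real.exp (-(x ^ 2 / 2)) :=
    funext (hermiteFn_eq k)
  rw [h0]
  have h1 : HasDerivAt (fun x : ℝ => Real.exp (-(x ^ 2 / 2))) (Real.exp (-(x ^ 2 / 2)) * (-x)) x := by
    have := (((hasDerivAt_pow 2 x).div_const 2).neg).exp
    simpa using this
  have h2 := (((hPoly k).hasDerivAt x).const_mul ((hnc k)⁻¹)).mul h1
  refine h2.congr_deriv ?_
  ring

lemma integrable_poly_gauss (p : Polynomial ℝ) :
    Integrable (fun x : ℝ => p.eval x * Real.exp (-(x ^ 2))) := by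
  have : (fun x : ℝ => p.eval x * Real.exp (-(x ^ 2))) =
      fun x => ∑ i ∈ p.support, p.coeff i * (x ^ i * Real.exp (-(x ^ 2))) := by
    funext x
    rw [Polynomial.eval_eq_sum, Polynomial.sum, Finset.sum_mul]
    simp only [mul_assoc]
  rw [this]
  refine integrable_finsetSum _ fun i _ => Integrable.const_mul ?_ _
  have := integrable_rpow_mul_exp_neg_mul_sq (b := 1) one_pos (s := i)
    (by have : (0 : ℝ) ≤ i := by positivity
        linarith)
  simpa using this

lemma hermiteFn_mul_eq (j k : ℕ) : (fun x => hermiteFn j x * hermiteFn k x) =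
    fun x => (Polynomial.C ((hnc j)⁻¹ * (hnc k)⁻¹) * hPoly j * hPoly k).eval x *
      Real.exp (-(x ^ 2)) := by
  funext x
  have h : Real.exp (-(x ^ 2)) = Real.exp (-(x ^ 2 / 2)) * Real.exp (-(x ^ 2 / 2)) := by
    rw [← Real.exp_add]; congr 1; ring
  rw [hermiteFn_eq, hermiteFn_eq, h]
  simp only [Polynomial.eval_mul, Polynomial.eval_C]
  ring

lemma hermiteFn_integrable (j k : ℕ) : Integrable (fun x => hermiteFn j x * hermiteFn k x) := by
  rw [hermiteFn_mul_eq]; exact integrable_poly_gauss _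

/-- integration by parts -/
lemma hermiteFn_ibp (j k : ℕ) :
    Real.sqrt ((j : ℝ) / 2) * (∫ x, hermiteFn (j - 1) x * hermiteFn k x) =
      Real.sqrt (((k : ℝ) + 1) / 2) * ∫ x, hermiteFn j x * hermiteFn (k + 1) x := by
  have hd : ∀ x, HasDerivAt (fun x => hermiteFn j x * hermiteFn k x)
      (2 * (Real.sqrt ((j : ℝ) / 2) * (hermiteFn (j - 1) x * hermiteFn k x) -
      Real.sqrt (((k : ℝ) + 1) / 2) * (hermiteFn j x * hermiteFn (k + 1) x))) x := by
    intro x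
    refine ((hermiteFn_hasDerivAt j x).mul (hermiteFn_hasDerivAt k x)).congr_deriv ?_
    have h1 := hermiteFn_mul_x j x
    have h2 := hermiteFn_mul_x k x
    linear_combination hermiteFn k x * h1 - hermiteFn j x * h2
  have i1 := (hermiteFn_integrable (j - 1) k).const_mul (Real.sqrt ((j : ℝ) / 2))
  have i2 := (hermiteFn_integrable j (k + 1)).const_mul (Real.sqrt (((k : ℝ) + 1) / 2))
  have := integral_eq_zero_of_hasDerivAt_of_integrable hd ((i1.sub i2).const_mul 2)
    (hermiteFn_integrable j k)
  rw [integral_const_mul, integral_sub i1 i2, integral_const_mul, integral_const_mul] at this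
  linarith

lemma hermiteFn_orth (j k : ℕ) :
    (∫ x, hermiteFn j x * hermiteFn k x) = if j = k then 1 else 0 := by
  induction k generalizing j with
  | zero =>
    cases j with
    | zero =>
      rw [hermiteFn_mul_eq]
      have h := integral_gaussian 1
      simp only [hPoly, Polynomial.eval_mul, Polynomial.eval_C, Polynomial.eval_one,
        integral_const_mul, mul_one]
      simp only [neg_mul, one_mul, div_one] at h
      rw [h]
      have : hnc 0 * hnc 0 = Real.sqrt Real.pi := by
        unfold hnc; rw [Real.mul_self_sqrt (by positivity)]; simp
      rw [← this]
      have := hnc_pos 0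
      simp
      field_simp
    | succ j =>
      have := hermiteFn_ibp 0 j
      have hp : 0 < Real.sqrt (((j : ℝ) + 1) / 2) := by positivity
      simp only [Nat.cast_zero, zero_div, Real.sqrt_zero, zero_mul] at this
      have h2 := (mul_eq_zero.1 this.symm).resolve_left hp.ne'
      simp only [mul_comm (hermiteFn (j + 1) _)]
      rw [h2]; simp
  | succ k ih =>
    have h := hermiteFn_ibp j k
    have hp : 0 < Real.sqrt (((k : ℝ) + 1) / 2) := by positivity
    rw [ih] at h
    cases j with
    | zero =>
      simp only [Nat.cast_zero, zero_div, Real.sqrt_zero, zero_mul] at h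
      rw [(mul_eq_zero.1 h.symm).resolve_left hp.ne']; simp
    | succ j =>
      simp only [Nat.add_sub_cancel, Nat.add_right_cancel_iff] at h ⊢
      split_ifs at h ⊢ with hjk
      · subst hjk
        push_cast at h
        exact mul_left_cancel₀ hp.ne' h.symm
      · simp only [mul_zero] at h
        exact (mul_eq_zero.1 h.symm).resolve_left hp.ne'

lemma phi_update {n : ℕ} (α : Fin n → ℕ) (j : Fin n) (k : ℕ) (x : EuclideanSpace ℝ (Fin n)) :
    hermitePhi (Function.update α j k) x =
      (hermiteFn k (x j) : ℂ) * ∏ i ∈ Finset.univ.erase j, (hermiteFn (α i) (x i) : ℂ) := by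
  unfold hermitePhi
  rw [← Finset.mul_prod_erase _ _ (Finset.mem_univ j)]
  congr 1
  · simp
  · refine Finset.prod_congr rfl fun i hi => ?_
    rw [Function.update_of_ne (Finset.ne_of_mem_erase hi)]

lemma phi_erase {n : ℕ} (α : Fin n → ℕ) (j : Fin n) (x : EuclideanSpace ℝ (Fin n)) :
    hermitePhi α x =
      (hermiteFn (α j) (x j) : ℂ) * ∏ i ∈ Finset.univ.erase j, (hermiteFn (α i) (x i) : ℂ) := by
  have := phi_update α j (α j) x
  rwa [Function.update_eq_self] at this

def dn {n : ℕ} (j : Fin n) (α : Fin n → ℕ) : Fin n → ℕ := Function.update α j (α j - 1)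
def up {n : ℕ} (j : Fin n) (α : Fin n → ℕ) : Fin n → ℕ := Function.update α j (α j + 1)

lemma phi_mul_x {n : ℕ} (α : Fin n → ℕ) (j : Fin n) (x : EuclideanSpace ℝ (Fin n)) :
    ((x j : ℝ) : ℂ) * hermitePhi α x =
      (Real.sqrt ((α j : ℝ) / 2) : ℂ) * hermitePhi (dn j α) x +
      (Real.sqrt (((α j : ℝ) + 1) / 2) : ℂ) * hermitePhi (up j α) x := by
  rw [dn, up, phi_update, phi_update, phi_erase α j]
  have h := congrArg (fun r : ℝ => (r : ℂ)) (hermiteFn_mul_x (α j) (x j))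
  simp only [Complex.ofReal_mul, Complex.ofReal_add] at h
  rw [← mul_assoc, h]
  ring

lemma phi_hasFDerivAt {n : ℕ} (α : Fin n → ℕ) (x : EuclideanSpace ℝ (Fin n)) :
    ∃ L : EuclideanSpace ℝ (Fin n) →L[ℝ] ℂ, HasFDerivAt (hermitePhi α) L x ∧
      ∀ j, L (EuclideanSpace.single j 1) = 
      (Real.sqrt ((α j : ℝ) / 2) : ℂ) * hermitePhi (dn j α) x -
      (Real.sqrt (((α j : ℝ) + 1) / 2) : ℂ) * hermitePhi (up j α) x := by
  have h1 : ∀ i : Fin n, HasFDerivAt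
      (fun y : EuclideanSpace ℝ (Fin n) => (hermiteFn (α i) (y i) : ℂ))
      ((EuclideanSpace.proj i : EuclideanSpace ℝ (Fin n) →L[ℝ] ℝ).smulRight
        ((Real.sqrt ((α i : ℝ) / 2) * hermiteFn (α i - 1) (x i) -
      Real.sqrt (((α i : ℝ) + 1) / 2) * hermiteFn (α i + 1) (x i) : ℝ) : ℂ)) x := by
    intro i
    have h := (hermiteFn_hasDerivAt (α i) (x i)).ofReal_comp
    have hp : HasFDerivAt (fun y : EuclideanSpace ℝ (Fin n) => y i)
      (EuclideanSpace.proj i : EuclideanSpace ℝ (Fin n) →L[ℝ] ℝ) x :=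
      (EuclideanSpace.proj i : EuclideanSpace ℝ (Fin n) →L[ℝ] ℝ).hasFDerivAt
    exact h.hasFDerivAt.comp x hp
  have h2 := HasFDerivAt.finsetProd (u := Finset.univ) (fun i _ => h1 i)
  refine ⟨_, h2, fun j => ?_⟩
  rw [dn, up, phi_update, phi_update]
  simp only [_root_.sum_apply, _root_.smul_apply,
    ContinuousLinearMap.smulRight_apply, PiLp.proj_apply, smul_eq_mul]
  rw [Finset.sum_eq_single j]
  · simp
    ring
  · intro i _ hij
    simp [hij]
  · simp

lemma phi_orth {n : ℕ} (α β : Fin n → ℕ) :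
    Integrable (fun x : EuclideanSpace ℝ (Fin n) => hermitePhi α x * hermitePhi β x) ∧
    (∫ x : EuclideanSpace ℝ (Fin n), hermitePhi α x * hermitePhi β x) = if α = β then 1 else 0 := by
  let F : Fin n → ℝ → ℂ := fun i t => ((hermiteFn (α i) t * hermiteFn (β i) t : ℝ) : ℂ)
  have hF : (fun x : EuclideanSpace ℝ (Fin n) => hermitePhi α x * hermitePhi β x) =
      (fun y : Fin n → ℝ => ∏ i, F i (y i)) ∘ (MeasurableEquiv.toLp 2 (Fin n → ℝ)).symm := by
    funext x
    simp only [hermitePhi, F, Function.comp, ← Finset.prod_mul_distrib, Complex.ofReal_mul]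
    rfl
  have mp := EuclideanSpace.volume_preserving_symm_measurableEquiv_toLp (Fin n)
  constructor
  · rw [hF, mp.integrable_comp_emb (MeasurableEquiv.measurableEmbedding _)]
    exact Integrable.fintype_prod fun i => (hermiteFn_integrable (α i) (β i)).ofReal
  · rw [hF]
    simp only [Function.comp_def]
    rw [mp.integral_comp (MeasurableEquiv.measurableEmbedding _)
      (fun y : Fin n → ℝ => ∏ i, F i (y i)), integral_fintype_prod_volume_eq_prod]
    have : ∀ i, ∫ t, F i t = if α i = β i then 1 else 0 := by
      intro i
      simp only [F]
      rw [integral_complex_ofReal, hermiteFn_orth]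
      split_ifs <;> simp
    simp only [this]
    split_ifs with h
    · subst h; simp
    · obtain ⟨i, hi⟩ := Function.ne_iff.1 h
      exact Finset.prod_eq_zero (Finset.mem_univ i) (by simp [hi])

lemma phi_conj {n : ℕ} (α : Fin n → ℕ) (x : EuclideanSpace ℝ (Fin n)) :
    (starRingEnd ℂ) (hermitePhi α x) = hermitePhi α x := by
  simp [hermitePhi]

lemma parseval {n : ℕ} {ι : Type*} (s : Finset ι) (σ : ι → Fin n → ℕ)
    (hσ : Set.InjOn σ s) (d : ι → ℂ) :
    Integrable (fun x : EuclideanSpace ℝ (Fin n) => ‖∑ i ∈ s, d i * hermitePhi (σ i) x‖ ^ 2) ∧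
    (∫ x : EuclideanSpace ℝ (Fin n), ‖∑ i ∈ s, d i * hermitePhi (σ i) x‖ ^ 2) =
      ∑ i ∈ s, ‖d i‖ ^ 2 := by
  classical
  have hexp : ∀ x : EuclideanSpace ℝ (Fin n),
      ((‖∑ i ∈ s, d i * hermitePhi (σ i) x‖ ^ 2 : ℝ) : ℂ) =
      ∑ i ∈ s, ∑ k ∈ s, (d i * (starRingEnd ℂ) (d k)) *
        (hermitePhi (σ i) x * hermitePhi (σ k) x) := by
    intro x
    rw [Complex.ofReal_pow, ← Complex.mul_conj', map_sum, Finset.sum_mul_sum]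
    refine Finset.sum_congr rfl fun i _ => Finset.sum_congr rfl fun k _ => ?_
    rw [map_mul, phi_conj]; ring
  have hint : ∀ i ∈ s, ∀ k ∈ s, Integrable (fun x : EuclideanSpace ℝ (Fin n) =>
      (d i * (starRingEnd ℂ) (d k)) * (hermitePhi (σ i) x * hermitePhi (σ k) x)) :=
    fun i _ k _ => (phi_orth (σ i) (σ k)).1.const_mul _
  have hI : Integrable (fun x : EuclideanSpace ℝ (Fin n) =>
      ((‖∑ i ∈ s, d i * hermitePhi (σ i) x‖ ^ 2 : ℝ) : ℂ)) := by
    simp only [hexp]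
    exact integrable_finsetSum _ fun i hi => integrable_finsetSum _ fun k hk => hint i hi k hk
  refine ⟨hI.re, ?_⟩
  apply Complex.ofReal_injective
  rw [← integral_complex_ofReal]
  simp only [hexp]
  rw [integral_finsetSum _ fun i hi => integrable_finsetSum _ fun k hk => hint i hi k hk]
  push_cast
  refine Finset.sum_congr rfl fun i hi => ?_
  rw [integral_finsetSum _ fun k hk => hint i hi k hk]
  simp only [integral_const_mul, (phi_orth _ _).2]
  rw [Finset.sum_eq_single i]
  · simp [Complex.mul_conj']
  · intro k hk hki
    rw [if_neg (fun h => hki (hσ hk hi h.symm))]; simp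
  · exact fun h => (h hi).elim

lemma span_repr {n M : ℕ} {f : EuclideanSpace ℝ (Fin n) → ℂ} (hf : f ∈ hermiteSpan n M) :
    ∃ (s : Finset (Fin n → ℕ)) (c : (Fin n → ℕ) → ℂ), (∀ α ∈ s, ∑ j, α j ≤ M) ∧
      f = fun x => ∑ α ∈ s, c α * hermitePhi α x := by
  have : {f | ∃ α : Fin n → ℕ, (∑ j, α j) ≤ M ∧ f = hermitePhi α} =
      hermitePhi '' {α : Fin n → ℕ | (∑ j, α j) ≤ M} := by
    ext g; simp [eq_comm]
  rw [hermiteSpan, this, Finsupp.mem_span_image_iff_linearCombination] at hf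
  obtain ⟨l, hl, rfl⟩ := hf
  refine ⟨l.support, l, fun α hα => hl hα, ?_⟩
  funext x
  simp [Finsupp.linearCombination_apply, Finsupp.sum]

lemma span_mem {n M : ℕ} {ι : Type*} (s : Finset ι) (σ : ι → Fin n → ℕ) (d : ι → ℂ)
    (h : ∀ i ∈ s, ∑ j, σ i j ≤ M) :
    (fun x => ∑ i ∈ s, d i * hermitePhi (σ i) x) ∈ hermiteSpan n M := by
  have : (fun x => ∑ i ∈ s, d i * hermitePhi (σ i) x) = ∑ i ∈ s, d i • hermitePhi (σ i) := by
    funext x; simp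
  rw [this]
  exact Submodule.sum_mem _ fun i hi => Submodule.smul_mem _ _
    (Submodule.subset_span ⟨σ i, h i hi, rfl⟩)

lemma sum_up {n : ℕ} (j : Fin n) (α : Fin n → ℕ) : ∑ i, up j α i = ∑ i, α i + 1 := by
  rw [up, Finset.sum_update_of_mem (Finset.mem_univ j),
    ← Finset.add_sum_erase _ _ (Finset.mem_univ j), Finset.sdiff_singleton_eq_erase]
  ring

lemma sum_dn {n : ℕ} (j : Fin n) (α : Fin n → ℕ) : ∑ i, dn j α i ≤ ∑ i, α i := by
  refine Finset.sum_le_sum fun i _ => ?_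
  rw [dn, Function.update_apply]
  split_ifs with h
  · subst h; omega
  · exact le_rfl

lemma up_inj {n : ℕ} (j : Fin n) : Function.Injective (up j) := by
  intro α β h
  funext i
  have := congrFun h i
  simp only [up, Function.update_apply] at this
  split_ifs at this with h
  · subst h; omega
  · exact this

lemma dn_injOn {n : ℕ} (j : Fin n) : Set.InjOn (dn j) {α : Fin n → ℕ | α j ≠ 0} := by
  intro α hα β hβ h
  funext i
  have := congrFun h i
  simp only [dn, Function.update_apply, Set.mem_ofPred_eq] at this hα hβ
  split_ifs at this with h
  · subst h; omega
  · exact this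

def Op {n : ℕ} (T : (EuclideanSpace ℝ (Fin n) → ℂ) → (EuclideanSpace ℝ (Fin n) → ℂ)) (m : ℕ) :
    Prop :=
  ∀ M : ℕ, ∀ f ∈ hermiteSpan n M, T f ∈ hermiteSpan n (M + m) ∧
    (∫ x, ‖T f x‖ ^ 2) ≤ 2 ^ m * ((Nat.factorial (M + m) : ℝ) / Nat.factorial M) *
      ∫ x, ‖f x‖ ^ 2

lemma op_ladder {n : ℕ} (j : Fin n) (ε : ℂ) (hε : ‖ε‖ = 1)
    (T : (EuclideanSpace ℝ (Fin n) → ℂ) → (EuclideanSpace ℝ (Fin n) → ℂ))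
    (hT : ∀ (s : Finset (Fin n → ℕ)) (c : (Fin n → ℕ) → ℂ) (x : EuclideanSpace ℝ (Fin n)),
      T (fun x => ∑ α ∈ s, c α * hermitePhi α x) x = ∑ α ∈ s, c α *
        ((Real.sqrt ((α j : ℝ) / 2) : ℂ) * hermitePhi (dn j α) x +
          ε * ((Real.sqrt (((α j : ℝ) + 1) / 2) : ℂ) * hermitePhi (up j α) x))) :
    Op T 1 := by
  classical
  intro M f hf
  obtain ⟨s, c, hs, rfl⟩ := span_repr hf
  set s' := s.filter (fun α => α j ≠ 0) with hs'
  let du : (Fin n → ℕ) → ℂ := fun α => c α * (Real.sqrt ((α j : ℝ) / 2) : ℂ)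
  let dv : (Fin n → ℕ) → ℂ := fun α => c α * (ε * (Real.sqrt (((α j : ℝ) + 1) / 2) : ℂ))
  have hTe : T (fun x => ∑ α ∈ s, c α * hermitePhi α x) =
      (fun x => ∑ α ∈ s', du α * hermitePhi (dn j α) x) +
        (fun x => ∑ α ∈ s, dv α * hermitePhi (up j α) x) := by
    funext x
    rw [hT, Pi.add_apply]
    have : ∑ α ∈ s', du α * hermitePhi (dn j α) x = ∑ α ∈ s, du α * hermitePhi (dn j α) x := by
      refine Finset.sum_subset (Finset.filter_subset _ _) fun α hα hα' => ?_
      have : α j = 0 := by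
        by_contra h
        exact hα' (Finset.mem_filter.2 ⟨hα, h⟩)
      simp [du, this]
    rw [this, ← Finset.sum_add_distrib]
    refine Finset.sum_congr rfl fun α _ => ?_
    simp only [du, dv]; ring
  obtain ⟨iu, eu⟩ := parseval s' (dn j) ((dn_injOn j).mono fun α hα => by
    have hα : α ∈ s' := hα
    exact (Finset.mem_filter.1 hα).2) du
  obtain ⟨iv, ev⟩ := parseval s (up j) (up_inj j).injOn dv
  obtain ⟨i0, e0⟩ := parseval s id Function.injective_id.injOn c
  simp only [id] at e0 i0
  rw [hTe]
  constructor
  · refine Submodule.add_mem _ (span_mem _ _ _ fun α hα => ?_) (span_mem _ _ _ fun α hα => ?_)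
    · have := hs α (Finset.mem_filter.1 hα).1
      have := sum_dn j α
      omega
    · rw [sum_up]
      have := hs α hα
      omega
  · have hle : (∫ x, ‖((fun x => ∑ α ∈ s', du α * hermitePhi (dn j α) x) +
        (fun x => ∑ α ∈ s, dv α * hermitePhi (up j α) x)) x‖ ^ 2) ≤
        ∫ x, (2 * ‖∑ α ∈ s', du α * hermitePhi (dn j α) x‖ ^ 2 +
          2 * ‖∑ α ∈ s, dv α * hermitePhi (up j α) x‖ ^ 2) := by
      refine integral_mono_of_nonneg (Filter.Eventually.of_forall fun x => by positivity)
        ((iu.const_mul 2).add (iv.const_mul 2)) (Filter.Eventually.of_forall fun x => ?_)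
      simp only [Pi.add_apply]
      have := norm_add_le (∑ α ∈ s', du α * hermitePhi (dn j α) x)
        (∑ α ∈ s, dv α * hermitePhi (up j α) x)
      have h0 := norm_nonneg (∑ α ∈ s', du α * hermitePhi (dn j α) x +
        ∑ α ∈ s, dv α * hermitePhi (up j α) x)
      nlinarith [sq_nonneg (‖∑ α ∈ s', du α * hermitePhi (dn j α) x‖ -
        ‖∑ α ∈ s, dv α * hermitePhi (up j α) x‖)]
    rw [integral_add (iu.const_mul 2) (iv.const_mul 2), integral_const_mul, integral_const_mul,
      eu, ev] at hle
    refine hle.trans ?_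
    have h1 : ∑ α ∈ s', ‖du α‖ ^ 2 ≤ ∑ α ∈ s, ‖du α‖ ^ 2 :=
      Finset.sum_le_sum_of_subset_of_nonneg (Finset.filter_subset _ _) fun _ _ _ => by positivity
    have h2 : 2 * ∑ α ∈ s, ‖du α‖ ^ 2 + 2 * ∑ α ∈ s, ‖dv α‖ ^ 2 ≤
        2 * ((M : ℝ) + 1) * ∑ α ∈ s, ‖c α‖ ^ 2 := by
      rw [Finset.mul_sum, Finset.mul_sum, Finset.mul_sum, ← Finset.sum_add_distrib]
      refine Finset.sum_le_sum fun α hα => ?_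
      have hj : (α j : ℝ) ≤ M := by
        exact_mod_cast (Finset.single_le_sum (f := α) (fun _ _ => Nat.zero_le _)
          (Finset.mem_univ j)).trans (hs α hα)
      simp only [du, dv, norm_mul, hε, one_mul, mul_pow, Complex.norm_real, Real.norm_eq_abs,
        sq_abs]
      rw [Real.sq_sqrt (by positivity), Real.sq_sqrt (by positivity)]
      nlinarith [sq_nonneg ‖c α‖]
    rw [e0, Nat.factorial_succ]
    have h3 : (0 : ℝ) < Nat.factorial M := by positivity
    have h4 : (2 : ℝ) ^ 1 * (((M + 1) * Nat.factorial M : ℕ) / (Nat.factorial M : ℝ)) =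
        2 * ((M : ℝ) + 1) := by
      push_cast; field_simp
    rw [h4]
    linarith

lemma op_x {n : ℕ} (j : Fin n) :
    Op (fun (f : EuclideanSpace ℝ (Fin n) → ℂ) x => ((x j : ℝ) : ℂ) * f x) 1 := by
  refine op_ladder j 1 (by simp) _ fun s c x => ?_
  rw [Finset.mul_sum]
  refine Finset.sum_congr rfl fun α _ => ?_
  rw [mul_left_comm, phi_mul_x, one_mul]

lemma op_d {n : ℕ} (j : Fin n) : Op (partialDerivE j) 1 := by
  refine op_ladder j (-1) (by simp) _ fun s c x => ?_
  choose L hL hL' using fun α : Fin n → ℕ => phi_hasFDerivAt α x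
  have := HasFDerivAt.fun_sum (u := s) (fun α _ => (hL α).const_mul (c α))
  rw [partialDerivE, this.fderiv]
  simp only [_root_.sum_apply, _root_.smul_apply, hL', smul_eq_mul]
  refine Finset.sum_congr rfl fun α _ => ?_
  ring

lemma op_id {n : ℕ} : Op (fun f : EuclideanSpace ℝ (Fin n) → ℂ => f) 0 := by
  intro M f hf
  refine ⟨hf, le_of_eq ?_⟩
  have : (Nat.factorial M : ℝ) ≠ 0 := by positivity
  simp [this]

lemma op_comp {n : ℕ} {T S : (EuclideanSpace ℝ (Fin n) → ℂ) → (EuclideanSpace ℝ (Fin n) → ℂ)}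
    {m k : ℕ} (hT : Op T m) (hS : Op S k) : Op (fun f => T (S f)) (k + m) := by
  intro M f hf
  obtain ⟨h1, h2⟩ := hS M f hf
  obtain ⟨h3, h4⟩ := hT _ _ h1
  rw [add_assoc] at h3 h4
  refine ⟨h3, h4.trans ?_⟩
  calc _ ≤ (2 : ℝ) ^ m * ((Nat.factorial (M + (k + m)) : ℝ) / Nat.factorial (M + k)) *
        (2 ^ k * ((Nat.factorial (M + k) : ℝ) / Nat.factorial M) * ∫ x, ‖f x‖ ^ 2) := by gcongr
    _ = _ := by
      have : (Nat.factorial (M + k) : ℝ) ≠ 0 := by positivity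
      have : (Nat.factorial M : ℝ) ≠ 0 := by positivity
      rw [pow_add]
      field_simp

lemma op_iter {n : ℕ} {T : (EuclideanSpace ℝ (Fin n) → ℂ) → (EuclideanSpace ℝ (Fin n) → ℂ)}
    (hT : Op T 1) (k : ℕ) : Op (fun f => T^[k] f) k := by
  induction k with
  | zero => exact op_id
  | succ k ih =>
    simp only [Function.iterate_succ_apply']
    exact op_comp hT ih

lemma op_multiDeriv {n : ℕ} (β : Fin n → ℕ) : Op (multiDerivE β) (∑ j, β j) := by
  rw [Fin.sum_univ_def]
  unfold multiDerivE
  induction List.finRange n with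
  | nil => exact op_id
  | cons j l ih =>
    simp only [List.foldr_cons, List.map_cons, List.sum_cons]
    rw [add_comm]
    exact op_comp (op_iter (op_d j) (β j)) ih

lemma op_pow {n : ℕ} (j : Fin n) (k : ℕ) :
    Op (fun (f : EuclideanSpace ℝ (Fin n) → ℂ) x => ((x j : ℝ) : ℂ) ^ k * f x) k := by
  induction k with
  | zero => simpa using op_id
  | succ k ih =>
    have := op_comp (op_x j) ih
    simpa only [pow_succ', mul_assoc] using this

lemma op_monomial {n : ℕ} (α : Fin n → ℕ) (s : Finset (Fin n)) :
    Op (fun (f : EuclideanSpace ℝ (Fin n) → ℂ) x => (∏ j ∈ s, ((x j : ℝ) : ℂ) ^ α j) * f x)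
      (∑ j ∈ s, α j) := by
  classical
  induction s using Finset.induction_on with
  | empty => simpa using op_id
  | insert j s hj ih =>
    have := op_comp (op_pow j (α j)) ih
    simp only [Finset.prod_insert hj, Finset.sum_insert hj]
    rw [add_comm]
    simpa only [mul_assoc] using this

/-- **Factorial-type weighted estimates for finite combinations of Hermite functions.**
For every `N ∈ ℕ`, `f ∈ E_N` and multi-indices `α, β ∈ ℕⁿ`,
`‖x^α ∂_x^β f‖_{L²(ℝⁿ)} ≤ 2^{(|α|+|β|)/2} √((N+|α|+|β|)!/N!) ‖f‖_{L²(ℝⁿ)}`. -/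
theorem hermite_factorial_estimate (n : ℕ) (hn : 1 ≤ n) (N : ℕ)
    (f : EuclideanSpace ℝ (Fin n) → ℂ) (hf : f ∈ hermiteSpan n N)
    (α β : Fin n → ℕ) :
    Real.sqrt (∫ x, ‖(∏ j, ((x j : ℝ) : ℂ) ^ α j) * multiDerivE β f x‖ ^ 2) ≤
      (2 : ℝ) ^ (((((∑ j, α j) + ∑ j, β j : ℕ)) : ℝ) / 2) *
        Real.sqrt ((Nat.factorial (N + (∑ j, α j) + ∑ j, β j) : ℝ) / Nat.factorial N) *
        Real.sqrt (∫ x, ‖f x‖ ^ 2) := by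

  obtain ⟨-, h⟩ := op_comp (op_monomial α Finset.univ) (op_multiDeriv β) N f hf
  rw [add_comm (∑ j, β j), ← add_assoc] at h
  refine (Real.sqrt_le_sqrt h).trans (le_of_eq ?_)
  rw [Real.sqrt_mul (by positivity), Real.sqrt_mul (by positivity)]
  congr 2
  rw [Real.sqrt_eq_rpow, ← Real.rpow_natCast, ← Real.rpow_mul (by norm_num)]
  congr 1
  ring
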